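/- If \alpha is irrational, then the skew translation A_\alpha(p,q) = (p+\alpha, q+2p) mod 1 of the two-torus is uniquely ergodic; in particular, Lebesgue measure is the only A_\alpha-invariant Borel probability measure on T^2. -/

import Mathlib

open MeasureTheory

namespace SkewAux

abbrev T1 := AddCircle (1 : ℝ)

/-- the character `(p,q) ↦ e(mp+nq)` -/
noncomputable def chi (m n : ℤ) : BoundedContinuousFunction (T1 × T1) ℂ :=
  BoundedContinuousFunction.mkOfCompact
    ⟨fun x => fourier m x.1 * fourier n x.2, by fun_prop⟩

lemma chi_apply (m n : ℤ) (x : T1 × T1) : chi m n x = fourier m x.1 * fourier n x.2 := rfl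

lemma chi_mul (m n m' n' : ℤ) (x : T1 × T1) :
    chi m n x * chi m' n' x = chi (m + m') (n + n') x := by
  simp only [chi_apply, fourier_add]; ring

lemma chi_conj (m n : ℤ) (x : T1 × T1) :
    (starRingEnd ℂ) (chi m n x) = chi (-m) (-n) x := by
  simp only [chi_apply, fourier_neg, map_mul]

lemma chi_zero (x : T1 × T1) : chi 0 0 x = 1 := by
  simp [chi_apply]

lemma fourier_add_arg (m : ℤ) (x y : T1) :
    fourier m (x + y) = fourier m x * fourier m y := by
  simp only [fourier_apply, smul_add, AddCircle.toCircle_add, Circle.coe_mul]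

lemma chi_skew (a : T1) (m n : ℤ) (x : T1 × T1) :
    chi m n (x.1 + a, x.2 + 2 • x.1) = fourier m a * chi (m + 2 * n) n x := by
  have h : (fourier n (2 • x.1) : ℂ) = fourier (2 * n) x.1 := by
    simp only [fourier_apply]
    congr 2
    rw [mul_comm, mul_smul, two_zsmul, two_nsmul]
  simp only [chi_apply, fourier_add_arg, fourier_add, h]
  ring

lemma norm_fourier_apply (m : ℤ) (a : T1) : ‖(fourier m a : ℂ)‖ = 1 := by
  rw [fourier_apply]; exact Circle.norm_coe _

lemma fourier_ne_one (α : ℝ) (hα : Irrational α) (m : ℤ) (hm : m ≠ 0) :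
    (fourier m (α : T1) : ℂ) ≠ 1 := by
  intro h
  rw [fourier_coe_apply, Complex.exp_eq_one_iff] at h
  obtain ⟨k, hk⟩ := h
  have h2 : (2 * Real.pi * Complex.I : ℂ) ≠ 0 := Complex.two_pi_I_ne_zero
  have h3 : ((m : ℂ) * α) = k := by
    apply mul_left_cancel₀ h2
    rw [mul_comm _ (k : ℂ), ← hk]
    push_cast
    ring
  have h4 : (m : ℝ) * α = k := by exact_mod_cast h3
  exact (hα.intCast_mul hm).ne_int k h4

lemma coeff_rec (a : T1) (μ : Measure (T1 × T1))
    (h : MeasurePreserving (fun x : T1 × T1 => (x.1 + a, x.2 + 2 • x.1)) μ μ) (m n : ℤ) :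
    ∫ x, chi m n x ∂μ = fourier m a * ∫ x, chi (m + 2 * n) n x ∂μ := by
  conv_lhs => rw [← h.map_eq]
  rw [integral_map h.measurable.aemeasurable
    (chi m n).continuous.aestronglyMeasurable]
  simp_rw [chi_skew]
  exact integral_const_mul _ _

lemma coeff_zero_right (α : ℝ) (hα : Irrational α) (μ : Measure (T1 × T1))
    (h : MeasurePreserving (fun x : T1 × T1 => (x.1 + (α : T1), x.2 + 2 • x.1)) μ μ)
    (m : ℤ) (hm : m ≠ 0) : ∫ x, chi m 0 x ∂μ = 0 := by
  have h1 := coeff_rec _ μ h m 0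
  rw [mul_zero, add_zero] at h1
  by_contra hne
  exact fourier_ne_one α hα m hm (mul_right_cancel₀ hne (by rw [← h1, one_mul]))

lemma coeff_norm (a : T1) (μ : Measure (T1 × T1))
    (h : MeasurePreserving (fun x : T1 × T1 => (x.1 + a, x.2 + 2 • x.1)) μ μ) (m n : ℤ) (k : ℕ) :
    ‖∫ x, chi (m + k * (2 * n)) n x ∂μ‖ = ‖∫ x, chi m n x ∂μ‖ := by
  induction k with
  | zero => simp
  | succ k ih =>
    rw [← ih, coeff_rec a μ h (m + k * (2 * n)) n, norm_mul, norm_fourier_apply, one_mul]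
    congr 4
    push_cast
    ring_nf

lemma coeff_eq_zero (α : ℝ) (hα : Irrational α) (μ : Measure (T1 × T1)) [IsProbabilityMeasure μ]
    (h : MeasurePreserving (fun x : T1 × T1 => (x.1 + (α : T1), x.2 + 2 • x.1)) μ μ)
    (m n : ℤ) (hmn : m ≠ 0 ∨ n ≠ 0) : ∫ x, chi m n x ∂μ = 0 := by
  rcases eq_or_ne n 0 with rfl | hn
  · exact coeff_zero_right α hα μ h m (by simpa using hmn)
  let v : ℕ → Lp ℂ 2 μ := fun k =>
    BoundedContinuousFunction.toLp 2 μ ℂ (chi (-(m + k * (2 * n))) (-n))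
  have hv : Orthonormal ℂ v := by
    rw [orthonormal_iff_ite]
    intro i j
    simp only [v, BoundedContinuousFunction.inner_toLp, chi_conj, chi_mul]
    split_ifs with hij
    · subst hij
      simp [chi_zero]
    · rw [show -n + - -n = 0 by ring]
      apply coeff_zero_right α hα μ h
      rw [show -(m + j * (2 * n)) + - -(m + i * (2 * n)) = ((i : ℤ) - j) * (2 * n) by ring]
      have : (i : ℤ) - j ≠ 0 := by omega
      positivity
  have hs := hv.inner_products_summable (BoundedContinuousFunction.toLp 2 μ ℂ (chi 0 0))
  have he : ∀ k, ‖inner ℂ (v k) (BoundedContinuousFunction.toLp 2 μ ℂ (chi 0 0))‖ ^ 2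
      = ‖∫ x, chi m n x ∂μ‖ ^ 2 := by
    intro k
    rw [← coeff_norm _ μ h m n k]
    simp only [v, BoundedContinuousFunction.inner_toLp, chi_conj, chi_mul, zero_add, neg_neg]
  simp_rw [he] at hs
  rw [summable_const_iff] at hs
  simpa using hs

/-- trigonometric polynomials -/
noncomputable def trig : StarSubalgebra ℂ (BoundedContinuousFunction (T1 × T1) ℂ) :=
  StarAlgebra.adjoin ℂ (Set.range fun k : ℤ × ℤ => chi k.1 k.2)

lemma trig_induct (f : BoundedContinuousFunction (T1 × T1) ℂ) (hf : f ∈ trig) :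
    f ∈ Submodule.span ℂ (Set.range fun k : ℤ × ℤ => chi k.1 k.2) := by
  set S := Set.range fun k : ℤ × ℤ => chi k.1 k.2 with hS
  have hmul : ∀ f ∈ S, ∀ g ∈ S, f * g ∈ S := by
    rintro _ ⟨k, rfl⟩ _ ⟨l, rfl⟩
    refine ⟨k + l, ?_⟩
    ext x
    exact (chi_mul _ _ _ _ x).symm
  have hstar : ∀ f ∈ S, star f ∈ S := by
    rintro _ ⟨k, rfl⟩
    refine ⟨-k, ?_⟩
    ext x
    exact (chi_conj _ _ x).symm
  have hone : (1 : BoundedContinuousFunction (T1 × T1) ℂ) ∈ S := by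
    refine ⟨0, ?_⟩
    ext x
    exact chi_zero x
  induction hf using StarAlgebra.adjoin_induction with
  | mem x hx => exact Submodule.subset_span hx
  | algebraMap r =>
    rw [Algebra.algebraMap_eq_smul_one]
    exact Submodule.smul_mem _ _ (Submodule.subset_span hone)
  | add x y _ _ hx hy => exact Submodule.add_mem _ hx hy
  | mul x y hx' hy' hx hy =>
    clear hx' hy'
    induction hx, hy using Submodule.span_induction₂ with
    | mem_mem x y hx hy => exact Submodule.subset_span (hmul x hx y hy)
    | zero_left => simp
    | zero_right => simp
    | add_left x y z _ _ _ h1 h2 => rw [add_mul]; exact Submodule.add_mem _ h1 h2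
    | add_right x y z _ _ _ h1 h2 => rw [mul_add]; exact Submodule.add_mem _ h1 h2
    | smul_left r x y _ _ h => rw [smul_mul_assoc]; exact Submodule.smul_mem _ _ h
    | smul_right r x y _ _ h => rw [mul_smul_comm]; exact Submodule.smul_mem _ _ h
  | star x hx' hx =>
    clear hx'
    induction hx using Submodule.span_induction with
    | mem x hx => exact Submodule.subset_span (hstar x hx)
    | zero => simp
    | add x y _ _ h1 h2 => rw [star_add]; exact Submodule.add_mem _ h1 h2
    | smul r x _ h => rw [star_smul]; exact Submodule.smul_mem _ _ h

lemma ext_coeff (μ ν : Measure (T1 × T1)) [IsProbabilityMeasure μ] [IsProbabilityMeasure ν]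
    (h : ∀ m n : ℤ, ∫ x, chi m n x ∂μ = ∫ x, chi m n x ∂ν) : μ = ν := by
  apply ext_of_forall_mem_subalgebra_integral_eq_of_pseudoEMetric_complete_countable (A := trig)
  · intro x y hxy
    have hinj : Function.Injective (fun z : T1 => (fourier 1 z : ℂ)) := by
      intro a b hab
      simp only [fourier_one] at hab
      exact AddCircle.injective_toCircle one_ne_zero (Subtype.coe_injective hab)
    have hmem : ∀ m n, ((chi m n : BoundedContinuousFunction (T1 × T1) ℂ)) ∈ trig :=
      fun m n => StarAlgebra.subset_adjoin ℂ _ ⟨(m, n), rfl⟩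
    by_cases h1 : x.1 = y.1
    · refine ⟨_, ⟨_, ⟨chi 0 1, hmem 0 1, rfl⟩, rfl⟩, ?_⟩
      intro he
      apply hxy
      refine Prod.ext h1 (hinj ?_)
      have he' : chi 0 1 x = chi 0 1 y := he
      simpa only [chi_apply, fourier_zero, one_mul] using he'
    · refine ⟨_, ⟨_, ⟨chi 1 0, hmem 1 0, rfl⟩, rfl⟩, ?_⟩
      intro he
      apply h1
      apply hinj
      have he' : chi 1 0 x = chi 1 0 y := he
      simpa only [chi_apply, fourier_zero, mul_one] using he'
  · intro g hg
    replace hg := trig_induct g hg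
    induction hg using Submodule.span_induction with
    | mem x hx =>
      obtain ⟨k, rfl⟩ := hx
      exact h _ _
    | zero => simp
    | add f g _ _ h1 h2 =>
      simp only [BoundedContinuousFunction.coe_add, Pi.add_apply]
      rw [integral_add (f.integrable _) (g.integrable _),
        integral_add (f.integrable _) (g.integrable _), h1, h2]
    | smul r f _ h =>
      simp only [BoundedContinuousFunction.coe_smul]
      rw [integral_smul, integral_smul, h]

lemma vol_prob : IsProbabilityMeasure (volume : Measure (T1 × T1)) := by
  constructor
  rw [← Set.univ_prod_univ, Measure.volume_eq_prod, Measure.prod_prod]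
  simp [AddCircle.measure_univ]

lemma vol_inv (a : T1) :
    MeasurePreserving (fun x : T1 × T1 => (x.1 + a, x.2 + 2 • x.1)) volume volume := by
  rw [Measure.volume_eq_prod]
  refine MeasurePreserving.skew_product (g := fun p q : T1 => q + 2 • p)
    (measurePreserving_add_right volume a) (by fun_prop) ?_
  exact Filter.Eventually.of_forall fun p => map_add_right_eq_self volume _

lemma unique (α : ℝ) (hα : Irrational α) (μ : Measure (T1 × T1)) (hμ : IsProbabilityMeasure μ)
    (h : MeasurePreserving (fun x : T1 × T1 => (x.1 + (α : T1), x.2 + 2 • x.1)) μ μ) :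
    μ = volume := by
  have := vol_prob
  apply ext_coeff
  intro m n
  by_cases hmn : m ≠ 0 ∨ n ≠ 0
  · rw [coeff_eq_zero α hα μ h m n hmn, coeff_eq_zero α hα volume (vol_inv _) m n hmn]
  · push Not at hmn
    obtain ⟨rfl, rfl⟩ := hmn
    simp [chi_zero]

end SkewAux

/-- If `α` is irrational, the skew translation
`A_α(p,q) = (p+α, q+2p) mod 1` of `T² = ℝ²/ℤ²` is uniquely ergodic: it has
exactly one invariant Borel probability measure; in particular Lebesgue (Haar)
measure is the only invariant Borel probability measure. -/
theorem skew_translation_uniquely_ergodic (α : ℝ) (hα : Irrational α) :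
    (∃! μ : Measure (AddCircle (1 : ℝ) × AddCircle (1 : ℝ)),
      IsProbabilityMeasure μ ∧
        MeasurePreserving
          (fun x : AddCircle (1 : ℝ) × AddCircle (1 : ℝ) =>
            (x.1 + ((α : ℝ) : AddCircle (1 : ℝ)), x.2 + 2 • x.1)) μ μ) ∧
    ∀ μ : Measure (AddCircle (1 : ℝ) × AddCircle (1 : ℝ)),
      IsProbabilityMeasure μ →
      MeasurePreserving
        (fun x : AddCircle (1 : ℝ) × AddCircle (1 : ℝ) =>
          (x.1 + ((α : ℝ) : AddCircle (1 : ℝ)), x.2 + 2 • x.1)) μ μ →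
      μ = volume := by
  refine ⟨⟨volume, ⟨SkewAux.vol_prob, SkewAux.vol_inv _⟩, ?_⟩, ?_⟩
  · rintro μ ⟨hμ, h⟩
    exact SkewAux.unique α hα μ hμ h
  · intro μ hμ h
    exact SkewAux.unique α hα μ hμ h
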